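/- Let α ∈ (0,1], T > 0, and let f : [0,T] × ℝ → ℝ be continuous and satisfy the Lipschitz condition with continuous L : [0,T] → [0,∞). Let x₁ and x₂ be solutions on [0,T] of the Caputo fractional initial value problems with the same f and initial values x₁₀ ≠ x₂₀. Then for all t ∈ [0,T]: |x₁(t) − x₂(t)| ≤ |x₁₀ − x₂₀| · E_α(L*(t) t^α), where L*(t) := max_{τ ∈ [0,t]} L(τ). -/

import Mathlib

open Set intervalIntegral

/-- The one-parameter Mittag-Leffler function `E_α(x) = ∑_{k=0}^∞ x^k / Γ(αk+1)`. -/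
noncomputable def mittagLeffler (α x : ℝ) : ℝ :=
  ∑' k : ℕ, x ^ k / Real.Gamma (α * (k : ℝ) + 1)

/-- A continuous function `x` on `[0,T]` solves the Caputo fractional initial value
problem `^C D^α_{0+} x(t) = f(t,x(t))`, `x(0) = x₀`, in the equivalent Volterra
integral formulation. -/
def IsCaputoSolution (α T : ℝ) (f : ℝ → ℝ → ℝ) (x₀ : ℝ) (x : ℝ → ℝ) : Prop :=
  ContinuousOn x (Set.Icc 0 T) ∧
    ∀ t ∈ Set.Icc 0 T,
      x t = x₀ + (1 / Real.Gamma α) * ∫ s in (0:ℝ)..t, (t - s) ^ (α - 1) * f s (x s)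

open MeasureTheory in
theorem rpow_mul_exp_neg_le_Gamma {R y : ℝ} (hR : 0 ≤ R) (hy : 0 ≤ y) :
    R ^ y * Real.exp (-R) ≤ Real.Gamma (y + 1) := by
  have hint : IntegrableOn (fun s : ℝ => Real.exp (-s) * s ^ (y + 1 - 1)) (Ioi 0) :=
    Real.GammaIntegral_convergent (by linarith)
  have hsub : Ioi R ⊆ Ioi (0 : ℝ) := Ioi_subset_Ioi hR
  rw [Real.Gamma_eq_integral (by linarith), ← integral_exp_neg_Ioi R, ← MeasureTheory.integral_const_mul]
  calc ∫ s in Ioi R, R ^ y * Real.exp (-s)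
      ≤ ∫ s in Ioi R, Real.exp (-s) * s ^ (y + 1 - 1) := by
        refine setIntegral_mono_on ((integrableOn_exp_neg_Ioi R).const_mul _)
          (hint.mono_set hsub) measurableSet_Ioi fun s hs => ?_
        rw [add_sub_cancel_right, mul_comm]
        gcongr
        exact le_of_lt hs
    _ ≤ ∫ s in Ioi 0, Real.exp (-s) * s ^ (y + 1 - 1) := by
        refine setIntegral_mono_set hint ?_ hsub.eventuallyLE
        filter_upwards [self_mem_ae_restrict measurableSet_Ioi] with s hs
        have : (0 : ℝ) < s := hs
        positivity

theorem summable_mittagLeffler {α x : ℝ} (hα : 0 < α) (hx : 0 ≤ x) :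
    Summable fun k : ℕ => x ^ k / Real.Gamma (α * (k : ℝ) + 1) := by
  set R : ℝ := (2 * x + 1) ^ α⁻¹ with hRdef
  have hR : 0 < R := by positivity
  have hRα : R ^ α = 2 * x + 1 := Real.rpow_inv_rpow (by positivity) hα.ne'
  have hgeom : Summable fun k : ℕ => Real.exp R * (x / (2 * x + 1)) ^ k := by
    refine (summable_geometric_of_lt_one (by positivity) ?_).mul_left _
    rw [div_lt_one (by positivity)]
    linarith
  refine Summable.of_nonneg_of_le (fun k => ?_) (fun k => ?_) hgeom
  · have := Real.Gamma_pos_of_pos (show 0 < α * (k : ℝ) + 1 by positivity)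
    positivity
  · have hle := rpow_mul_exp_neg_le_Gamma hR.le (show 0 ≤ α * (k : ℝ) by positivity)
    rw [Real.rpow_mul hR.le, hRα, Real.rpow_natCast] at hle
    calc x ^ k / Real.Gamma (α * (k : ℝ) + 1)
        ≤ x ^ k / ((2 * x + 1) ^ k * Real.exp (-R)) := by gcongr
      _ = Real.exp R * (x / (2 * x + 1)) ^ k := by
        rw [Real.exp_neg, div_pow]
        field_simp

theorem integral_rpow_sub_mul_rpow {a b s : ℝ} (ha : 0 < a) (hb : 0 < b) (hs : 0 < s) :
    ∫ r in (0 : ℝ)..s, (s - r) ^ (a - 1) * r ^ (b - 1)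
      = s ^ (b + a - 1) * (Real.Gamma b * Real.Gamma a / Real.Gamma (b + a)) := by
  apply Complex.ofReal_injective
  have h := Complex.betaIntegral_scaled (b : ℂ) (a : ℂ) hs
  rw [Complex.betaIntegral_eq_Gamma_mul_div _ _ (by simpa) (by simpa)] at h
  rw [← intervalIntegral.integral_ofReal]
  calc ∫ r in (0 : ℝ)..s, (((s - r) ^ (a - 1) * r ^ (b - 1) : ℝ) : ℂ)
      = ∫ r in (0 : ℝ)..s, (r : ℂ) ^ ((b : ℂ) - 1) * ((s : ℂ) - r) ^ ((a : ℂ) - 1) := by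
        refine intervalIntegral.integral_congr fun r hr => ?_
        rw [uIcc_of_le hs.le] at hr
        have h1 : 0 ≤ s - r := by linarith [hr.2]
        simp only [Complex.ofReal_mul, Complex.ofReal_cpow h1, Complex.ofReal_cpow hr.1]
        push_cast
        ring
    _ = _ := by
        rw [h]
        push_cast [Complex.ofReal_cpow hs.le, ← Complex.Gamma_ofReal]
        ring

theorem intervalIntegrable_rpow_sub_mul {α s : ℝ} (hα : 0 < α) (hs : 0 ≤ s) {g : ℝ → ℝ}
    (hg : ContinuousOn g (Icc 0 s)) :
    IntervalIntegrable (fun r => (s - r) ^ (α - 1) * g r) MeasureTheory.volume 0 s := by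
  have h : IntervalIntegrable (fun r : ℝ => r ^ (α - 1)) MeasureTheory.volume s 0 :=
    intervalIntegral.intervalIntegrable_rpow' (by linarith)
  have h' := h.comp_sub_left s
  rw [sub_self, sub_zero] at h'
  exact h'.mul_continuousOn (by rwa [uIcc_of_le hs])

/-- The Riemann–Liouville integral of order `α`, based at `0`. -/
noncomputable def riemannLiouville (α : ℝ) (g : ℝ → ℝ) (s : ℝ) : ℝ :=
  (1 / Real.Gamma α) * ∫ r in (0 : ℝ)..s, (s - r) ^ (α - 1) * g r

theorem riemannLiouville_mono {α s : ℝ} (hα : 0 < α) (hs : 0 ≤ s) {g h : ℝ → ℝ}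
    (hg : ContinuousOn g (Icc 0 s)) (hh : ContinuousOn h (Icc 0 s))
    (hgh : ∀ r ∈ Icc 0 s, g r ≤ h r) :
    riemannLiouville α g s ≤ riemannLiouville α h s := by
  have := Real.Gamma_pos_of_pos hα
  refine mul_le_mul_of_nonneg_left ?_ (by positivity)
  refine intervalIntegral.integral_mono_on hs (intervalIntegrable_rpow_sub_mul hα hs hg)
    (intervalIntegrable_rpow_sub_mul hα hs hh) fun r hr => ?_
  exact mul_le_mul_of_nonneg_left (hgh r hr) (Real.rpow_nonneg (by linarith [hr.2]) _)

theorem riemannLiouville_const_mul (α c s : ℝ) (g : ℝ → ℝ) :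
    riemannLiouville α (fun r => c * g r) s = c * riemannLiouville α g s := by
  simp only [riemannLiouville, mul_left_comm _ c, intervalIntegral.integral_const_mul]

theorem riemannLiouville_sum {ι : Type*} {α s : ℝ} (hα : 0 < α) (hs : 0 ≤ s) (A : Finset ι)
    {g : ι → ℝ → ℝ} (hg : ∀ i ∈ A, ContinuousOn (g i) (Icc 0 s)) :
    riemannLiouville α (fun r => ∑ i ∈ A, g i r) s = ∑ i ∈ A, riemannLiouville α (g i) s := by
  simp only [riemannLiouville, Finset.mul_sum]
  rw [intervalIntegral.integral_finsetSum fun i hi =>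
    intervalIntegrable_rpow_sub_mul hα hs (hg i hi), Finset.mul_sum]

theorem riemannLiouville_add {α s : ℝ} (hα : 0 < α) (hs : 0 ≤ s) {g h : ℝ → ℝ}
    (hg : ContinuousOn g (Icc 0 s)) (hh : ContinuousOn h (Icc 0 s)) :
    riemannLiouville α (g + h) s
      = riemannLiouville α g s + riemannLiouville α h s := by
  simp only [riemannLiouville, Pi.add_apply, mul_add]
  rw [intervalIntegral.integral_add (intervalIntegrable_rpow_sub_mul hα hs hg)
    (intervalIntegrable_rpow_sub_mul hα hs hh), mul_add]

theorem riemannLiouville_sub {α s : ℝ} (hα : 0 < α) (hs : 0 ≤ s) {g h : ℝ → ℝ}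
    (hg : ContinuousOn g (Icc 0 s)) (hh : ContinuousOn h (Icc 0 s)) :
    riemannLiouville α (fun r => g r - h r) s
      = riemannLiouville α g s - riemannLiouville α h s := by
  simp only [riemannLiouville, mul_sub]
  rw [intervalIntegral.integral_sub (intervalIntegrable_rpow_sub_mul hα hs hg)
    (intervalIntegrable_rpow_sub_mul hα hs hh), mul_sub]

theorem abs_riemannLiouville_le {α s : ℝ} (hα : 0 < α) (hs : 0 ≤ s) (g : ℝ → ℝ) :
    |riemannLiouville α g s| ≤ riemannLiouville α (fun r => |g r|) s := by
  have := Real.Gamma_pos_of_pos hα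
  rw [riemannLiouville, abs_mul, abs_of_pos (by positivity : 0 < 1 / Real.Gamma α)]
  refine mul_le_mul_of_nonneg_left ?_ (by positivity)
  refine (intervalIntegral.abs_integral_le_integral_abs hs).trans_eq ?_
  refine intervalIntegral.integral_congr fun r hr => ?_
  rw [uIcc_of_le hs] at hr
  simp only [abs_mul, abs_of_nonneg (Real.rpow_nonneg (sub_nonneg.2 hr.2) (α - 1))]

theorem riemannLiouville_rpow_div_Gamma {α β s : ℝ} (hα : 0 < α) (hβ : 0 ≤ β) (hs : 0 ≤ s) :
    riemannLiouville α (fun r => r ^ β / Real.Gamma (β + 1)) s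
      = s ^ (β + α) / Real.Gamma (β + α + 1) := by
  rcases hs.eq_or_lt with rfl | hs
  · simp [riemannLiouville, Real.zero_rpow (by positivity : β + α ≠ 0)]
  have h := integral_rpow_sub_mul_rpow hα (by linarith : 0 < β + 1) hs
  have h1 := (Real.Gamma_pos_of_pos hα).ne'
  have h2 := (Real.Gamma_pos_of_pos (by linarith : 0 < β + 1)).ne'
  simp only [riemannLiouville, ← mul_div_assoc, intervalIntegral.integral_div]
  simp only [add_sub_cancel_right] at h
  rw [h, show β + 1 + α - 1 = β + α by ring, show β + 1 + α = β + α + 1 by ring]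
  field_simp

theorem le_partial_sum_of_le_add_riemannLiouville {α t M d C : ℝ} (hα : 0 < α)
    (hM : 0 ≤ M) {u : ℝ → ℝ} (hu : ContinuousOn u (Icc 0 t)) (huC : ∀ s ∈ Icc 0 t, u s ≤ C)
    (hle : ∀ s ∈ Icc 0 t, u s ≤ d + M * riemannLiouville α u s) (n : ℕ) :
    ∀ s ∈ Icc 0 t, u s ≤
      ∑ k ∈ Finset.range n, d * M ^ k * (s ^ (α * (k : ℝ)) / Real.Gamma (α * (k : ℝ) + 1))
        + C * M ^ n * (s ^ (α * (n : ℝ)) / Real.Gamma (α * (n : ℝ) + 1)) := by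
  induction n with
  | zero => simpa using huC
  | succ n ih =>
    intro s hs
    have hcont : ∀ (c : ℝ) (k : ℕ) (S : Set ℝ), ContinuousOn
        (fun r : ℝ => c * (r ^ (α * (k : ℝ)) / Real.Gamma (α * (k : ℝ) + 1))) S := fun c k S =>
      (((Real.continuous_rpow_const (by positivity)).div_const _).const_mul c).continuousOn
    have hsub : Icc 0 s ⊆ Icc 0 t := Icc_subset_Icc_right hs.2
    have hstep : ∀ (c : ℝ) (k : ℕ), riemannLiouville α
        (fun r : ℝ => c * (r ^ (α * (k : ℝ)) / Real.Gamma (α * (k : ℝ) + 1))) s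
        = c * (s ^ (α * ((k + 1 : ℕ) : ℝ)) / Real.Gamma (α * ((k + 1 : ℕ) : ℝ) + 1)) := by
      intro c k
      rw [riemannLiouville_const_mul,
        riemannLiouville_rpow_div_Gamma hα (by positivity) hs.1]
      push_cast
      rw [mul_add, mul_one]
    have hsum : ContinuousOn (fun r : ℝ => ∑ k ∈ Finset.range n,
        d * M ^ k * (r ^ (α * (k : ℝ)) / Real.Gamma (α * (k : ℝ) + 1))) (Icc 0 s) :=
      continuousOn_finsetSum _ fun k _ => hcont _ k _
    have hmono := riemannLiouville_mono hα hs.1 (hu.mono hsub) (hsum.add (hcont (C * M ^ n) n _))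
      fun r hr => ih r (hsub hr)
    rw [riemannLiouville_add hα hs.1 hsum (hcont _ n _),
      riemannLiouville_sum hα hs.1 _ fun k _ => hcont _ k _] at hmono
    simp only [hstep] at hmono
    refine (hle s hs).trans ((add_le_add_right (mul_le_mul_of_nonneg_left hmono hM) d).trans_eq ?_)
    rw [Finset.sum_range_succ', mul_add, Finset.mul_sum]
    simp only [Nat.cast_zero, mul_zero, Real.rpow_zero, zero_add, Real.Gamma_one, pow_zero,
      div_one, mul_one]
    rw [add_comm (Finset.sum _ _) d, add_assoc]
    congr 2
    · exact Finset.sum_congr rfl fun k _ => by ring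
    · ring

/-- A Grönwall inequality for the Riemann–Liouville integral. -/
theorem le_mittagLeffler_of_le_add_riemannLiouville {α t M d : ℝ} (hα : 0 < α) (ht : 0 ≤ t)
    (hM : 0 ≤ M) {u : ℝ → ℝ} (hu : ContinuousOn u (Icc 0 t))
    (hle : ∀ s ∈ Icc 0 t, u s ≤ d + M * riemannLiouville α u s) :
    u t ≤ d * mittagLeffler α (M * t ^ α) := by
  obtain ⟨C, hC⟩ := isCompact_Icc.bddAbove_image hu
  have hbound := fun n => le_partial_sum_of_le_add_riemannLiouville hα hM hu
    (fun s hs => hC (mem_image_of_mem u hs)) hle n t (right_mem_Icc.2 ht)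
  have hterm : ∀ (c : ℝ) (k : ℕ),
      c * M ^ k * (t ^ (α * (k : ℝ)) / Real.Gamma (α * (k : ℝ) + 1))
        = c * ((M * t ^ α) ^ k / Real.Gamma (α * (k : ℝ) + 1)) := by
    intro c k
    rw [mul_pow, ← Real.rpow_natCast (t ^ α), ← Real.rpow_mul ht]
    ring
  simp only [hterm, ← Finset.mul_sum] at hbound
  have hsum := summable_mittagLeffler hα (show 0 ≤ M * t ^ α by positivity)
  have hlim := (hsum.hasSum.tendsto_sum_nat.const_mul d).add
    (hsum.tendsto_atTop_zero.const_mul C)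
  rw [mul_zero, add_zero] at hlim
  exact ge_of_tendsto' hlim hbound

/-- Upper bound for the separation of two solutions:
`|x₁(t) − x₂(t)| ≤ |x₁₀ − x₂₀| · E_α(L*(t)·t^α)` where `L*(t) = max_{τ∈[0,t]} L(τ)`. -/
theorem caputo_separation_upper_bound (α T : ℝ) (hα : 0 < α) (hα1 : α ≤ 1) (hT : 0 < T)
    (f : ℝ → ℝ → ℝ)
    (hf : ContinuousOn (fun p : ℝ × ℝ => f p.1 p.2) (Set.Icc 0 T ×ˢ Set.univ))
    (L : ℝ → ℝ) (hLc : ContinuousOn L (Set.Icc 0 T))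
    (hLnn : ∀ t ∈ Set.Icc 0 T, 0 ≤ L t)
    (hLip : ∀ t ∈ Set.Icc 0 T, ∀ x y : ℝ, |f t x - f t y| ≤ L t * |x - y|)
    (x₁₀ x₂₀ : ℝ) (hne : x₁₀ ≠ x₂₀) (x₁ x₂ : ℝ → ℝ)
    (hx₁ : IsCaputoSolution α T f x₁₀ x₁) (hx₂ : IsCaputoSolution α T f x₂₀ x₂) :
    ∀ t ∈ Set.Icc 0 T,
      |x₁ t - x₂ t|
        ≤ |x₁₀ - x₂₀| * mittagLeffler α (sSup (L '' Set.Icc 0 t) * t ^ α) := by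
  intro t ht
  have hsubT : Icc 0 t ⊆ Icc 0 T := Icc_subset_Icc_right ht.2
  have hbdd : BddAbove (L '' Icc 0 t) := isCompact_Icc.bddAbove_image (hLc.mono hsubT)
  have hLle : ∀ r ∈ Icc 0 t, L r ≤ sSup (L '' Icc 0 t) := fun r hr =>
    le_csSup hbdd (mem_image_of_mem L hr)
  have hM : 0 ≤ sSup (L '' Icc 0 t) :=
    (hLnn t ht).trans (hLle t (right_mem_Icc.2 ht.1))
  have hfx : ∀ x : ℝ → ℝ, ContinuousOn x (Icc 0 T) →
      ContinuousOn (fun r => f r (x r)) (Icc 0 T) := fun x hx =>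
    hf.comp (continuousOn_id.prodMk hx) fun r hr => ⟨hr, mem_univ _⟩
  have hu : ContinuousOn (fun s => |x₁ s - x₂ s|) (Icc 0 T) := (hx₁.1.sub hx₂.1).abs
  refine le_mittagLeffler_of_le_add_riemannLiouville (u := fun s => |x₁ s - x₂ s|) hα ht.1 hM
    (hu.mono hsubT) fun s hs => ?_
  have hsT := hsubT hs
  have hsub : Icc 0 s ⊆ Icc 0 T := Icc_subset_Icc_right hsT.2
  have hg₁ := (hfx x₁ hx₁.1).mono hsub
  have hg₂ := (hfx x₂ hx₂.1).mono hsub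
  have hdiff : x₁ s - x₂ s
      = (x₁₀ - x₂₀) + riemannLiouville α (fun r => f r (x₁ r) - f r (x₂ r)) s := by
    rw [riemannLiouville_sub hα hs.1 hg₁ hg₂, hx₁.2 s hsT, hx₂.2 s hsT, riemannLiouville,
      riemannLiouville]
    ring
  calc |x₁ s - x₂ s|
      ≤ |x₁₀ - x₂₀| + |riemannLiouville α (fun r => f r (x₁ r) - f r (x₂ r)) s| := by
        rw [hdiff]
        exact abs_add_le _ _
    _ ≤ |x₁₀ - x₂₀| + riemannLiouville α (fun r => |f r (x₁ r) - f r (x₂ r)|) s := by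
        gcongr
        exact abs_riemannLiouville_le hα hs.1 _
    _ ≤ |x₁₀ - x₂₀| + riemannLiouville α
          (fun r => sSup (L '' Icc 0 t) * |x₁ r - x₂ r|) s := by
        gcongr
        refine riemannLiouville_mono hα hs.1 (hg₁.sub hg₂).abs
          ((hu.mono hsub).const_mul _) fun r hr => ?_
        exact (hLip r (hsub hr) _ _).trans
          (mul_le_mul_of_nonneg_right (hLle r ⟨hr.1, hr.2.trans hs.2⟩) (abs_nonneg _))
    _ = |x₁₀ - x₂₀| + sSup (L '' Icc 0 t) * riemannLiouville α (fun r => |x₁ r - x₂ r|) s := by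
        rw [riemannLiouville_const_mul]
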